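/- Fixed-point convergence of the Crank–Nicolson iteration: let 0 < L < 1 and K = (6−L)/(1−L). If λ = Δt/Δx ≤ L/(K‖v‖_{h²}), then the iteration w_{l+1} = v + Δt·G((v+w_l)/2) + (Δt/2)·ℍ(D₊D₋(v+w_{l+1})), w_0 = v, converges in h² to a limit u satisfying u = v + Δt·G((v+u)/2) + Δt·ℍ(D₊D₋(v+u)/2), and ‖u‖_{h²} ≤ K‖v‖_{h²}. -/

import Mathlib

open Filter

/-- Differences for grid functions on ℤ. -/
noncomputable def Dp (Δx : ℝ) (u : ℤ → ℝ) (j : ℤ) : ℝ := (u (j + 1) - u j) / Δx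
noncomputable def Dm (Δx : ℝ) (u : ℤ → ℝ) (j : ℤ) : ℝ := (u j - u (j - 1)) / Δx

/-- Discrete h² norm. -/
noncomputable def h2norm (Δx : ℝ) (p : ℤ → ℝ) : ℝ :=
  Real.sqrt (Δx * ∑' j : ℤ, (p j) ^ 2 + Δx * ∑' j : ℤ, (Dp Δx p j) ^ 2
    + Δx * ∑' j : ℤ, (Dp Δx (Dm Δx p) j) ^ 2)

/-- Discrete nonlinearity G(u)_j = ũ_j (Du)_j. -/
noncomputable def Gnl (Δx : ℝ) (u : ℤ → ℝ) (j : ℤ) : ℝ :=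
  (u (j + 1) + u j + u (j - 1)) / 3 * ((u (j + 1) - u (j - 1)) / (2 * Δx))

/-- Discrete Hilbert transform on ℤ. -/
noncomputable def Hdisc (u : ℤ → ℝ) (j : ℤ) : ℝ :=
  (1 / Real.pi) * ∑' k : ℤ, if k = j then 0
    else u k * (1 - (-1 : ℝ) ^ (j - k)) / ((j : ℝ) - (k : ℝ))



/-- The real Hilbert space ℓ²(ℤ). -/
abbrev E2 := lp (fun _ : ℤ => ℝ) 2

theorem two_toReal_pos : 0 < (2 : ENNReal).toReal := by norm_num

theorem memE_iff (f : ℤ → ℝ) : Memℓp f 2 ↔ Summable (fun j => f j ^ 2) := by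
  rw [memℓp_gen_iff two_toReal_pos]
  simp

/-- Build an element of ℓ² from a square summable sequence. -/
def mkE (f : ℤ → ℝ) (hf : Summable (fun j => f j ^ 2)) : E2 := ⟨f, (memE_iff f).2 hf⟩

@[simp] theorem mkE_apply (f : ℤ → ℝ) (hf) (j : ℤ) : mkE f hf j = f j := rfl

theorem E_summable (x : E2) : Summable (fun j => x j ^ 2) := (memE_iff x).1 x.2

theorem E_inner (x y : E2) : inner ℝ x y = ∑' j, x j * y j := by
  rw [lp.inner_eq_tsum]
  congr 1; ext j; simp [mul_comm]

theorem E_hasSum_inner (x y : E2) : HasSum (fun j => x j * y j) (inner ℝ x y) := by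
  have := lp.hasSum_inner (𝕜 := ℝ) x y
  simpa [mul_comm] using this

theorem E_norm_sq (x : E2) : ‖x‖ ^ 2 = ∑' j, x j ^ 2 := by
  rw [← real_inner_self_eq_norm_sq, E_inner]
  congr 1; ext j; ring

theorem E_ext {x y : E2} (h : ∀ j, x j = y j) : x = y := lp.ext (funext h)

theorem E_abs_le (x : E2) (j : ℤ) : |x j| ≤ ‖x‖ := by
  have := lp.norm_apply_le_norm (by norm_num : (2 : ENNReal) ≠ 0) x j
  simpa using this

@[simp] theorem E_add (x y : E2) (j : ℤ) : (x + y) j = x j + y j := rfl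
@[simp] theorem E_sub (x y : E2) (j : ℤ) : (x - y) j = x j - y j := rfl
@[simp] theorem E_smul (c : ℝ) (y : E2) (j : ℤ) : (c • y) j = c * y j := rfl

/-- multiplication by a bounded sequence -/
theorem exists_mul (b : ℤ → ℝ) (m : ℝ) (hm : 0 ≤ m) (hb : ∀ j, |b j| ≤ m) (y : E2) :
    ∃ z : E2, (∀ j, z j = b j * y j) ∧ ‖z‖ ≤ m * ‖y‖ := by
  have hle : ∀ j, (b j * y j) ^ 2 ≤ m ^ 2 * y j ^ 2 := by
    intro j
    rw [mul_pow]
    have := sq_le_sq' (by linarith [neg_abs_le (b j), hb j]) (le_trans (le_abs_self _) (hb j))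
    gcongr
  have hs : Summable (fun j => (b j * y j) ^ 2) :=
    Summable.of_nonneg_of_le (fun j => sq_nonneg _) hle ((E_summable y).mul_left _)
  refine ⟨mkE _ hs, fun j => rfl, ?_⟩
  refine le_of_sq_le_sq ?_ (by positivity)
  rw [mul_pow, E_norm_sq, E_norm_sq, ← tsum_mul_left]
  exact hs.tsum_le_tsum hle ((E_summable y).mul_left _)

theorem hasSum_of_eq {ι : Type*} {f g : ι → ℝ} {a b : ℝ} (h : HasSum f a) (hf : ∀ n, g n = f n)
    (ha : b = a) : HasSum g b := by
  rw [ha, funext hf]; exact h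

theorem shift_summable (n : ℤ) (x : E2) : Summable (fun j => x (j + n) ^ 2) :=
  (E_summable x).comp_injective (add_left_injective n)

/-- shift of a sequence -/
noncomputable def shf (n : ℤ) (x : E2) : E2 := mkE (fun j => x (j + n)) (shift_summable n x)

theorem shf_apply (n : ℤ) (x : E2) (j : ℤ) : shf n x j = x (j + n) := rfl

theorem shf_norm (n : ℤ) (x : E2) : ‖shf n x‖ = ‖x‖ := by
  have : ‖shf n x‖ ^ 2 = ‖x‖ ^ 2 := by
    rw [E_norm_sq, E_norm_sq]
    simp only [shf_apply]
    exact (Equiv.addRight n).tsum_eq (fun j => x j ^ 2)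
  exact (pow_left_inj₀ (norm_nonneg _) (norm_nonneg _) two_ne_zero).1 this

/-- shift operator -/
noncomputable def Sh (n : ℤ) : E2 →ₗᵢ[ℝ] E2 where
  toFun x := shf n x
  map_add' x y := by apply E_ext; intro j; simp only [shf_apply, E_add]
  map_smul' c y := by apply E_ext; intro j; simp only [shf_apply, E_smul, RingHom.id_apply]
  norm_map' x := shf_norm n x

@[simp] theorem Sh_apply (n : ℤ) (x : E2) (j : ℤ) : Sh n x j = x (j + n) := rfl

theorem Sh_inner (n : ℤ) (x y : E2) : inner ℝ (Sh n x) y = inner ℝ x (Sh (-n) y) := by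
  rw [E_inner, E_inner, ← (Equiv.addRight n).tsum_eq (fun j => x j * Sh (-n) y j)]
  simp

/-- the Hilbert kernel -/
noncomputable def hk (n : ℤ) : ℝ := (1 - (-1 : ℝ) ^ n) / (Real.pi * n)

theorem hk_even {n : ℤ} (h : Even n) : hk n = 0 := by simp [hk, h.neg_one_zpow]
theorem hk_odd {n : ℤ} (h : Odd n) : hk n = 2 / (Real.pi * n) := by
  simp only [hk, h.neg_one_zpow]; norm_num
theorem hk_neg (n : ℤ) : hk (-n) = - hk n := by
  rcases Int.even_or_odd n with h | h
  · rw [hk_even h, hk_even h.neg]; simp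
  · rw [hk_odd h, hk_odd h.neg]; push_cast; rw [mul_neg, div_neg]

theorem Hdisc_eq (u : ℤ → ℝ) (j : ℤ) : Hdisc u j = ∑' k, u k * hk (j - k) := by
  rw [Hdisc, ← tsum_mul_left]
  congr 1; ext k
  split_ifs with h
  · subst h; simp [hk]
  · have h1 : (j : ℝ) - k ≠ 0 := by
      intro h2; apply h; have : (j : ℝ) = k := by linarith
      exact (by exact_mod_cast this.symm)
    have := Real.pi_ne_zero
    simp only [hk]; push_cast; field_simp

theorem odd_ne_zero {n : ℤ} (h : Odd n) : (n : ℝ) ≠ 0 := by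
  intro h0
  have : n = 0 := by exact_mod_cast h0
  subst this; simp at h

theorem hk_hasSum_sq : HasSum (fun n : ℤ => hk n ^ 2) 1 := by
  have h1 := hasSum_zeta_two
  have h2 : HasSum (fun n : ℕ => (1 + (-1 : ℝ) ^ n) / (n : ℝ) ^ 2) (Real.pi ^ 2 / 12) := by
    have hinj : Function.Injective (fun m : ℕ => 2 * m) := fun a b h => by simpa using h
    rw [← hinj.hasSum_iff]
    · have := h1.mul_left (1 / 2 : ℝ)
      refine hasSum_of_eq this (fun m => ?_) (by ring)
      simp; ring
    · intro n hn
      have : Odd n := by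
        rw [← Nat.not_even_iff_odd]
        rintro ⟨m, rfl⟩
        exact hn ⟨m, by simp only; ring⟩
      simp [this.neg_one_pow]
  have h3 : HasSum (fun n : ℕ => hk n ^ 2) (1 / 2) := by
    have := ((h1.mul_left 2).sub h2).mul_left (2 / Real.pi ^ 2)
    have hpi := Real.pi_ne_zero
    refine hasSum_of_eq this (fun n => ?_) (by field_simp; norm_num)
    · rcases Nat.even_or_odd n with h | h
      · rw [hk_even (by exact_mod_cast h), h.neg_one_pow]; ring
      · rw [hk_odd (by exact_mod_cast h), h.neg_one_pow]; push_cast; ring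
  have h4 := HasSum.of_nat_of_neg (f := fun n : ℤ => hk n ^ 2) h3 (by simpa [hk_neg] using h3)
  refine hasSum_of_eq h4 (fun _ => rfl) ?_
  norm_num [hk]

theorem hk_tendsto : Tendsto hk cofinite (nhds 0) := by
  have h := hk_hasSum_sq.summable.tendsto_cofinite_zero
  have h2 := (Real.continuous_sqrt.tendsto 0).comp h
  simp only [Real.sqrt_zero] at h2
  rw [tendsto_zero_iff_abs_tendsto_zero]
  refine h2.congr (fun n => ?_)
  simp [Real.sqrt_sq_eq_abs]

theorem telescope (f : ℤ → ℝ) (hf : Tendsto f cofinite (nhds 0))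
    (hs : Summable (fun n => f n - f (n + 1))) : ∑' n, (f n - f (n + 1)) = 0 := by
  have i1 : Function.Injective (fun n : ℕ => (n : ℤ)) := fun a b h => by simpa using h
  have i2 : Function.Injective (fun n : ℕ => (-((n : ℤ) + 1))) := fun a b h => by simpa using h
  have i3 : Function.Injective (fun n : ℕ => (-(n : ℤ))) := fun a b h => by simpa using h
  have s1 := hs.comp_injective i1
  have s2 := hs.comp_injective i2
  have t1 : Tendsto (fun n : ℕ => f 0 - f n) atTop (nhds (f 0 - 0)) :=
    tendsto_const_nhds.sub (by
      have := hf.comp i1.tendsto_cofinite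
      rwa [Nat.cofinite_eq_atTop] at this)
  have t2 : Tendsto (fun n : ℕ => f (-(n : ℤ)) - f 0) atTop (nhds (0 - f 0)) :=
    Tendsto.sub (by
      have := hf.comp i3.tendsto_cofinite
      rwa [Nat.cofinite_eq_atTop] at this) tendsto_const_nhds
  have e1 : ∑' n : ℕ, (f n - f (n + 1)) = f 0 - 0 := by
    refine tendsto_nhds_unique s1.hasSum.tendsto_sum_nat (t1.congr fun n => ?_)
    have := Finset.sum_range_sub' (fun n : ℕ => f n) n
    simp only [Nat.cast_zero] at this
    rw [← this]; simp
  have e2 : ∑' n : ℕ, (f (-((n : ℤ) + 1)) - f (-((n : ℤ) + 1) + 1)) = 0 - f 0 := by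
    refine tendsto_nhds_unique s2.hasSum.tendsto_sum_nat (t2.congr fun n => ?_)
    have := Finset.sum_range_sub (fun n : ℕ => f (-(n : ℤ))) n
    simp only [Nat.cast_zero, neg_zero] at this
    rw [← this]; refine Finset.sum_congr rfl fun i _ => ?_
    simp
  have h1 : HasSum (fun n : ℕ => f n - f (n + 1)) (f 0 - 0) := by rw [← e1]; exact s1.hasSum
  have h2 : HasSum (fun n : ℕ => (f (-((n : ℤ) + 1)) - f (-((n : ℤ) + 1) + 1))) (0 - f 0) := by
    rw [← e2]; exact s2.hasSum
  have := HasSum.of_nat_of_neg_add_one (f := fun n : ℤ => f n - f (n + 1)) h1 h2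
  rw [this.tsum_eq]; ring

/-- the kernel as an element of ℓ² (column `k`) -/
noncomputable def hcol (k : ℤ) : E2 :=
  mkE (fun j => hk (j - k)) ((Equiv.subRight k).summable_iff.2 hk_hasSum_sq.summable)

theorem hcol_apply (k j : ℤ) : hcol k j = hk (j - k) := rfl

theorem hk_mul {n p : ℤ} (hp : Even p) (hp0 : p ≠ 0) :
    hk n * hk (n + p) = 2 / (Real.pi * p) * (hk n - hk (n + p)) := by
  rcases Int.even_or_odd n with h | h
  · rw [hk_even h, hk_even (h.add hp)]; simp
  · have h2 := odd_ne_zero (h.add_even hp)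
    have h1 := odd_ne_zero h
    rw [hk_odd h, hk_odd (h.add_even hp)]
    have := Real.pi_ne_zero
    have hp' : (p : ℝ) ≠ 0 := by exact_mod_cast hp0
    push_cast at h2 ⊢
    field_simp; ring

theorem hk_orth_nat (p : ℕ) (hp0 : p ≠ 0) : ∑' n, hk n * hk (n + p) = 0 := by
  rcases Nat.even_or_odd p with hp | hp
  · have hp' : Even (p : ℤ) := by exact_mod_cast hp
    have hp0' : (p : ℤ) ≠ 0 := by exact_mod_cast hp0
    have hsum : Summable (fun n => hk n * hk (n + p)) := by
      have := (E_hasSum_inner (hcol 0) (Sh p (hcol 0))).summable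
      simpa [hcol_apply] using this
    have hp1 : (p : ℝ) ≠ 0 := by exact_mod_cast hp0
    have hpi := Real.pi_ne_zero
    have heq : ∀ n : ℤ, hk n - hk (n + p) = (Real.pi * p / 2) * (hk n * hk (n + p)) := by
      intro n; rw [hk_mul hp' hp0']; push_cast; field_simp
    let f : ℤ → ℝ := fun n => ∑ i ∈ Finset.range p, hk (n + i)
    have hf : ∀ n, f n - f (n + 1) = hk n - hk (n + p) := by
      intro n
      simp only [f, ← Finset.sum_sub_distrib]
      have := Finset.sum_range_sub' (fun i : ℕ => hk (n + i)) p
      simp only [Nat.cast_zero, add_zero] at this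
      rw [← this]
      refine Finset.sum_congr rfl fun i _ => ?_
      push_cast; congr 2; ring
    have hft : Tendsto f cofinite (nhds 0) := by
      have : Tendsto f cofinite (nhds (∑ i ∈ Finset.range p, (0 : ℝ))) :=
        tendsto_finsetSum _ fun i _ =>
          hk_tendsto.comp (add_left_injective (i : ℤ)).tendsto_cofinite
      simpa using this
    have h0 := telescope f hft (by
      simp only [hf, heq]; exact hsum.mul_left _)
    simp only [hf, heq, tsum_mul_left] at h0
    rcases mul_eq_zero.1 h0 with h | h
    · exfalso; revert h; positivity
    · exact h
  · have : ∀ n : ℤ, hk n * hk (n + p) = 0 := by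
      intro n
      have hp' : Odd (p : ℤ) := by exact_mod_cast hp
      rcases Int.even_or_odd n with h | h
      · rw [hk_even h, zero_mul]
      · rw [hk_even (h.add_odd hp'), mul_zero]
    simp [this]

theorem hcol_orthonormal : Orthonormal ℝ hcol := by
  have key : ∀ k l : ℤ, k < l → inner ℝ (hcol k) (hcol l) = 0 := by
    intro k l hkl
    rw [E_inner, ← (Equiv.addRight l).tsum_eq (fun j => hcol k j * hcol l j)]
    have := hk_orth_nat (l - k).toNat (by omega)
    rw [Int.toNat_of_nonneg (by omega)] at this
    rw [← this]
    congr 1; ext n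
    simp only [hcol_apply, Equiv.coe_addRight]
    rw [mul_comm]; congr 2 <;> ring
  constructor
  · intro k
    have : ‖hcol k‖ ^ 2 = 1 := by
      rw [E_norm_sq]
      have := (Equiv.subRight k).tsum_eq (fun j => hk j ^ 2)
      rw [hk_hasSum_sq.tsum_eq] at this
      simpa [hcol_apply] using this
    nlinarith [norm_nonneg (hcol k)]
  · intro k l hkl
    rcases lt_or_gt_of_ne hkl with h | h
    · exact key k l h
    · rw [real_inner_comm]; exact key l k h

/-- The discrete Hilbert transform as an isometry of ℓ². -/
noncomputable def HL : E2 →ₗᵢ[ℝ] E2 := hcol_orthonormal.orthogonalFamily.linearIsometry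

theorem HL_hasSum (u : E2) : HasSum (fun k => u k • hcol k) (HL u) := by
  have := hcol_orthonormal.orthogonalFamily.hasSum_linearIsometry u
  simp only [LinearIsometry.toSpanSingleton_apply] at this
  exact this

theorem HL_hasSum_apply (u : E2) (j : ℤ) : HasSum (fun k => u k * hk (j - k)) (HL u j) := by
  have := (HL_hasSum u).mapL (lp.evalCLM ℝ (fun _ : ℤ => ℝ) 2 j)
  exact this

theorem HL_apply (u : E2) (j : ℤ) : HL u j = Hdisc u j := by
  rw [Hdisc_eq, (HL_hasSum_apply u j).tsum_eq]

theorem HL_skew (u v : E2) : inner ℝ (HL u) v = - inner ℝ u (HL v) := by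
  have h1 : HasSum (fun k => u k * inner ℝ (hcol k) v) (inner ℝ (HL u) v) := by
    have := (HL_hasSum u).mapL ((innerSL ℝ (E := E2)).flip v)
    refine hasSum_of_eq this (fun k => ?_) rfl
    change _ = inner ℝ (u k • hcol k) v
    rw [real_inner_smul_left]
  rw [← h1.tsum_eq, E_inner, ← tsum_neg]
  congr 1; ext k
  rw [E_inner, ← (HL_hasSum_apply v k).tsum_eq, ← mul_neg, ← tsum_neg]
  congr 2; ext j
  rw [hcol_apply, ← neg_sub k j, hk_neg]; ring

theorem HL_Sh (n : ℤ) (u : E2) : HL (Sh n u) = Sh n (HL u) := by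
  apply E_ext; intro j
  rw [Sh_apply, ← (HL_hasSum_apply _ _).tsum_eq, ← (HL_hasSum_apply _ _).tsum_eq,
    ← (Equiv.addRight n).tsum_eq (fun k => u k * hk (j + n - k))]
  simp

theorem HL_skew_self (u : E2) : inner ℝ (HL u) u = 0 := by
  have := HL_skew u u
  rw [real_inner_comm u] at this
  rw [real_inner_comm]; linarith


/-- `S + S⁻¹ - a` -/
noncomputable def Na (a : ℝ) : E2 →L[ℝ] E2 :=
  (Sh 1).toContinuousLinearMap + (Sh (-1)).toContinuousLinearMap
    - a • ContinuousLinearMap.id ℝ E2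

theorem Na_eq (a : ℝ) (x : E2) : Na a x = Sh 1 x + Sh (-1) x - a • x := rfl

theorem Na_apply (a : ℝ) (x : E2) (j : ℤ) : Na a x j = x (j + 1) + x (j - 1) - a * x j := rfl

theorem Na_HL (a : ℝ) (x : E2) : HL (Na a x) = Na a (HL x) := by
  simp only [Na_eq, map_sub, map_add, map_smul, HL_Sh]

theorem Na_symm (a : ℝ) (x y : E2) : inner ℝ (Na a x) y = inner ℝ x (Na a y) := by
  simp only [Na_eq, inner_sub_left, inner_add_left, inner_sub_right, inner_add_right, Sh_inner,
    real_inner_smul_left, real_inner_smul_right, neg_neg]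
  ring

theorem T_skew (a : ℝ) (x : E2) : inner ℝ (HL (Na a x)) x = 0 := by
  have h1 := HL_skew (Na a x) x
  rw [Na_symm, ← Na_HL, real_inner_comm (HL (Na a x)) x] at h1
  linarith

theorem energy (a c : ℝ) (x e : E2) (h : x = e + c • HL (Na a x)) : ‖x‖ ≤ ‖e‖ := by
  have h1 : ‖x‖ ^ 2 = inner ℝ e x := by
    rw [← real_inner_self_eq_norm_sq]
    have h0 : inner ℝ x x = inner ℝ (e + c • HL (Na a x)) x := by rw [← h]
    rw [h0, inner_add_left, real_inner_smul_left, T_skew]; ring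
  have h2 := real_inner_le_norm e x
  by_contra h3
  push Not at h3
  nlinarith [norm_nonneg e, norm_nonneg x]

theorem energy_iso (a c : ℝ) (x y e : E2) (h : x = y + e + c • HL (Na a (y + x))) :
    ‖x‖ ≤ ‖y‖ + ‖e‖ := by
  have h1 : inner ℝ (x - y - e) (y + x) = 0 := by
    have : x - y - e = c • HL (Na a (y + x)) := by
      conv_lhs => rw [h]
      abel
    rw [this, real_inner_smul_left, T_skew]; ring
  have h2 : inner ℝ (x - y) (y + x) = ‖x‖ ^ 2 - ‖y‖ ^ 2 := by
    rw [inner_sub_left, inner_add_right, inner_add_right, real_inner_self_eq_norm_sq,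
      real_inner_self_eq_norm_sq, real_inner_comm]; ring
  rw [inner_sub_left, h2] at h1
  have h3 := real_inner_le_norm e (y + x)
  have h4 := norm_add_le y x
  by_contra h5
  push Not at h5
  have := mul_le_mul_of_nonneg_left h4 (norm_nonneg e)
  nlinarith [norm_nonneg e, norm_nonneg x, norm_nonneg y]

theorem solve (a c : ℝ) (r : E2) : ∃ q : E2, q = r + c • HL (Na a q) := by
  let A : E2 →L[ℝ] E2 :=
    ContinuousLinearMap.id ℝ E2 - c • (HL.toContinuousLinearMap ∘L Na a)
  have hA : ∀ x, A x = x - c • HL (Na a x) := fun x => rfl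
  let B : E2 →L[ℝ] E2 →L[ℝ] ℝ := (innerSL ℝ (E := E2)).comp A
  have hB : ∀ x y, B x y = inner ℝ (A x) y := fun x y => rfl
  have hc : IsCoercive B := by
    refine ⟨1, one_pos, fun u => ?_⟩
    rw [hB, hA, inner_sub_left, real_inner_smul_left, T_skew, real_inner_self_eq_norm_sq]
    apply le_of_eq; ring
  obtain ⟨q, hq⟩ := hc.continuousLinearEquivOfBilin.surjective r
  refine ⟨q, ?_⟩
  have : A q = r := by
    rw [← hq]
    refine ext_inner_right ℝ fun y => ?_
    rw [hc.continuousLinearEquivOfBilin_apply, hB]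
  rw [hA] at this
  rw [← this]; abel


/-- weighted summability -/
def WS (g : ℤ → ℝ) : Prop := Summable (fun k : ℤ => |g k| / (1 + |(k : ℝ)|))

theorem one_le_abs_odd {n : ℤ} (h : Odd n) : 1 ≤ |(n : ℝ)| := by
  have : n ≠ 0 := by rintro rfl; simp at h
  have := Int.one_le_abs this
  exact_mod_cast this

theorem hk_abs_le (n : ℤ) : |hk n| ≤ 2 / (1 + |(n : ℝ)|) := by
  rcases Int.even_or_odd n with h | h
  · rw [hk_even h, abs_zero]; positivity
  · have h1 := one_le_abs_odd h
    rw [hk_odd h, abs_div, abs_mul, abs_of_pos Real.pi_pos, abs_two]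
    apply div_le_div_of_nonneg_left (by norm_num) (by positivity)
    nlinarith [Real.pi_gt_three]

theorem hk_abs_ge {n : ℤ} (h : Odd n) : 1 / (1 + |(n : ℝ)|) ≤ 2 * |hk n| := by
  have h1 := one_le_abs_odd h
  have hp := Real.pi_pos
  have := Real.pi_lt_four
  rw [hk_odd h, abs_div, abs_mul, abs_of_pos hp, abs_two, ← mul_div_assoc,
    div_le_div_iff₀ (by positivity) (by positivity)]
  nlinarith

theorem wt_le (j k : ℤ) : 1 / (1 + |((j - k : ℤ) : ℝ)|) ≤ (1 + |(j : ℝ)|) / (1 + |(k : ℝ)|) := by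
  rw [div_le_div_iff₀ (by positivity) (by positivity)]
  push_cast
  have := abs_sub_abs_le_abs_sub (k : ℝ) j
  rw [abs_sub_comm] at this
  nlinarith [mul_nonneg (abs_nonneg (j : ℝ)) (abs_nonneg ((j : ℝ) - k))]

theorem wt_ge (j k : ℤ) : 1 / (1 + |(k : ℝ)|) ≤ (1 + |(j : ℝ)|) * (1 / (1 + |((j - k : ℤ) : ℝ)|)) := by
  have := wt_le j (j - k)
  rw [sub_sub_cancel] at this
  rw [mul_one_div]; exact this

theorem WS.summable {g : ℤ → ℝ} (hg : WS g) (j : ℤ) : Summable (fun k => g k * hk (j - k)) := by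
  refine Summable.of_norm_bounded (hg.mul_left (2 * (1 + |(j : ℝ)|))) fun k => ?_
  rw [Real.norm_eq_abs, abs_mul]
  have h1 := hk_abs_le (j - k)
  have h2 := wt_le j k
  calc |g k| * |hk (j - k)| ≤ |g k| * (2 * ((1 + |(j : ℝ)|) / (1 + |(k : ℝ)|))) := by
        refine mul_le_mul_of_nonneg_left (h1.trans ?_) (abs_nonneg _)
        rw [← mul_one_div]; linarith
    _ = _ := by ring

theorem WS_of_sq {g : ℤ → ℝ} (hg : Summable fun j => g j ^ 2) : WS g := by
  have hw : Summable (fun k : ℤ => (1 / (1 + |(k : ℝ)|)) ^ 2) := by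
    have : Summable (fun k : ℤ => 1 / (k : ℝ) ^ 2) := Real.summable_one_div_int_pow.2 one_lt_two
    refine Summable.of_norm_bounded_eventually this ?_
    rw [eventually_cofinite]
    refine (Set.finite_singleton (0 : ℤ)).subset fun k hk => ?_
    by_contra h0
    apply hk
    have : 0 < |(k : ℝ)| := abs_pos.2 (by exact_mod_cast h0)
    rw [Real.norm_of_nonneg (by positivity), div_pow, one_pow, ← sq_abs (k : ℝ)]
    apply div_le_div_of_nonneg_left (by norm_num) (by positivity)
    nlinarith
  refine Summable.of_nonneg_of_le (fun k => by positivity) (fun k => ?_) (hg.add hw)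
  rw [← mul_one_div]
  nlinarith [sq_nonneg (|g k| - 1 / (1 + |(k : ℝ)|)), sq_abs (g k), sq_nonneg (g k),
    sq_nonneg (1 / (1 + |(k : ℝ)|))]

theorem WS.add {f g : ℤ → ℝ} (hf : WS f) (hg : WS g) : WS (fun k => f k + g k) := by
  refine Summable.of_nonneg_of_le (fun k => by positivity) (fun k => ?_) (Summable.add hf hg)
  rw [← add_div]; gcongr; exact abs_add_le _ _

theorem WS.smul {f : ℤ → ℝ} (c : ℝ) (hf : WS f) : WS (fun k => c * f k) := by
  refine (Summable.mul_left |c| hf).congr fun k => ?_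
  rw [abs_mul]; ring

theorem kappa (n : ℤ) : n * (hk n - hk (n - 2)) = -2 * hk (n - 2) := by
  rcases Int.even_or_odd n with h | h
  · rw [hk_even h, hk_even (h.sub even_two)]; simp
  · have h2 := odd_ne_zero (h.sub_even even_two)
    have h1 := odd_ne_zero h
    rw [hk_odd h, hk_odd (h.sub_even even_two)]
    have := Real.pi_ne_zero
    push_cast at h2 ⊢
    field_simp; ring

/-- the regularising weight -/
noncomputable def th (ε : ℝ) (k : ℤ) : ℝ := 1 / (1 + ε ^ 2 * (k : ℝ) ^ 2)

theorem th_pos (ε : ℝ) (k : ℤ) : 0 < th ε k := by unfold th; positivity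
theorem th_le (ε : ℝ) (k : ℤ) : th ε k ≤ 1 := by
  unfold th; rw [div_le_one (by positivity)]; nlinarith [sq_nonneg (ε * k)]

theorem th_x {ε : ℝ} (hε : 0 < ε) (k : ℤ) : |ε * k * th ε k| ≤ 1 := by
  have h : (0 : ℝ) < 1 + ε ^ 2 * (k : ℝ) ^ 2 := by positivity
  rw [th, mul_one_div, abs_div, abs_of_pos h, div_le_one h]
  have := sq_abs (ε * k)
  nlinarith [sq_nonneg (|ε * k| - 1)]

theorem th_ratio {ε : ℝ} (hε : 0 < ε) (h1 : ε ≤ 1) (k s : ℤ) (hs : |(s : ℝ)| ≤ 2) :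
    |th ε k / th ε (k + s) - 1| ≤ 8 * ε := by
  have h : (0 : ℝ) < 1 + ε ^ 2 * (k : ℝ) ^ 2 := by positivity
  have e : th ε k / th ε (k + s) - 1 = (ε ^ 2 * (2 * k * s + s ^ 2)) / (1 + ε ^ 2 * (k : ℝ) ^ 2) := by
    simp only [th]; push_cast; field_simp; ring
  rw [e, abs_div, abs_of_pos h, div_le_iff₀ h, abs_mul, abs_of_pos (by positivity : 0 < ε ^ 2)]
  have h2 : |2 * (k : ℝ) * s + s ^ 2| ≤ 4 * |(k : ℝ)| + 4 := by
    refine (abs_add_le _ _).trans ?_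
    rw [abs_mul, abs_mul, abs_two, abs_pow]
    have := abs_nonneg (k : ℝ)
    have := abs_nonneg (s : ℝ)
    nlinarith
  have h3 : ε * |(k : ℝ)| ≤ (1 + ε ^ 2 * (k : ℝ) ^ 2) / 2 := by
    rw [← sq_abs (k : ℝ)]; nlinarith [sq_nonneg (ε * |(k : ℝ)| - 1)]
  calc ε ^ 2 * |2 * (k : ℝ) * s + s ^ 2| ≤ ε ^ 2 * (4 * |(k : ℝ)| + 4) := by gcongr
    _ = ε * (4 * (ε * |(k : ℝ)|) + 4 * ε) := by ring
    _ ≤ ε * (4 * ((1 + ε ^ 2 * (k : ℝ) ^ 2) / 2) + 4 * 1) := by gcongr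
    _ ≤ 8 * ε * (1 + ε ^ 2 * (k : ℝ) ^ 2) := by
        have : 0 ≤ ε * (ε ^ 2 * (k : ℝ) ^ 2) := by positivity
        nlinarith

/-- key regularised identity and estimate -/
theorem reg_est (a c : ℝ) (z g : ℤ → ℝ) (hg : WS g)
    (hgz : ∀ j, g j = z (j + 1) + z (j - 1) - a * z j)
    (hz : ∀ j, z j = c * ∑' k, g k * hk (j - k))
    (ε : ℝ) (hε : 0 < ε) (h1 : ε ≤ 1) (p x : E2) (hp : ∀ k, p k = th ε k * g k)
    (hx : ∀ k, x k = ε * k * th ε k * g k) :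
    ∃ Z : E2, (∀ j, Z j = th ε j * (z j - z (j - 2))) ∧
      ‖Z‖ ≤ |c| * (10 * ε * ‖p‖ + 2 * ε * ‖x‖ + 16 * ε * ‖Z‖) := by
  obtain ⟨y1, hy1, ny1⟩ := exists_mul (fun j => ε * j * th ε j) 1 zero_le_one (th_x hε)
    (Sh (-2) (HL p))
  obtain ⟨y2, hy2, ny2⟩ := exists_mul (fun j => th ε j) 1 zero_le_one
    (fun j => by rw [abs_of_pos (th_pos _ _)]; exact th_le _ _) (Sh (-2) (HL x))
  have hHp := fun j => HL_hasSum_apply p j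
  have hHx := fun j => HL_hasSum_apply x j
  let Z : E2 := c • (HL p - Sh (-2) (HL p) + (2 * ε) • y1 + (2 * ε) • y2)
  have hZ : ∀ j, Z j = th ε j * (z j - z (j - 2)) := by
    intro j
    have e1 : HasSum (fun k => th ε j * (g k * hk (j - k) - g k * hk (j - 2 - k)))
        (th ε j * (∑' k, g k * hk (j - k) - ∑' k, g k * hk (j - 2 - k))) :=
      ((hg.summable j).hasSum.sub (hg.summable (j - 2)).hasSum).mul_left _
    have e2 : HasSum (fun k => p k * hk (j - k) - p k * hk (j - 2 - k)
        + 2 * ε * (ε * j * th ε j * (p k * hk (j - 2 - k)))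
        + 2 * ε * (th ε j * (x k * hk (j - 2 - k))))
        (HL p j - HL p (j - 2) + 2 * ε * (ε * j * th ε j * HL p (j - 2))
          + 2 * ε * (th ε j * HL x (j - 2))) :=
      (((hHp j).sub (hHp (j - 2))).add (((hHp (j - 2)).mul_left _).mul_left _)).add
        (((hHx (j - 2)).mul_left _).mul_left _)
    have e3 : (fun k => th ε j * (g k * hk (j - k) - g k * hk (j - 2 - k))) =
        (fun k => p k * hk (j - k) - p k * hk (j - 2 - k)
        + 2 * ε * (ε * j * th ε j * (p k * hk (j - 2 - k)))
        + 2 * ε * (th ε j * (x k * hk (j - 2 - k)))) := by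
      ext k
      rw [hp, hx]
      have hka := kappa (j - k)
      have ej : j - 2 - k = j - k - 2 := by ring
      rw [ej]
      have hd : th ε j - th ε k = -(ε ^ 2 * (j + k) * ((j - k : ℤ) : ℝ)) * th ε j * th ε k := by
        simp only [th]; push_cast; field_simp; ring
      have : (th ε j - th ε k) * (hk (j - k) - hk (j - k - 2)) * g k
          = 2 * ε ^ 2 * (j + k) * th ε j * th ε k * hk (j - k - 2) * g k := by
        rw [hd]
        linear_combination (-(ε ^ 2 * (j + k)) * th ε j * th ε k * g k) * hka
      linear_combination this
    rw [e3] at e1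
    have e4 := e1.unique e2
    have e5 : Z j = c * (HL p j - HL p (j - 2) + 2 * ε * (ε * j * th ε j * HL p (j - 2))
          + 2 * ε * (th ε j * HL x (j - 2))) := by
      simp only [Z, E_smul, E_add, E_sub, hy1, hy2, Sh_apply]
      rfl
    rw [e5, ← e4]
    conv_rhs => rw [hz j, hz (j - 2)]
    ring
  refine ⟨Z, hZ, ?_⟩
  obtain ⟨y3, hy3, ny3⟩ := exists_mul (fun k => th ε k / th ε (k + (-2)) - 1) (8 * ε)
    (by positivity) (fun k => th_ratio hε h1 k (-2) (by norm_num)) (Sh (-2) p)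
  obtain ⟨y4, hy4, ny4⟩ := exists_mul (fun k => th ε k / th ε (k + 1) - 1) (8 * ε)
    (by positivity) (fun k => th_ratio hε h1 k 1 (by norm_num)) (Sh 1 Z)
  obtain ⟨y5, hy5, ny5⟩ := exists_mul (fun k => th ε k / th ε (k + (-1)) - 1) (8 * ε)
    (by positivity) (fun k => th_ratio hε h1 k (-1) (by norm_num)) (Sh (-1) Z)
  rw [LinearIsometry.norm_map] at ny3 ny4 ny5
  rw [LinearIsometry.norm_map, LinearIsometry.norm_map, one_mul] at ny1 ny2
  have hsplit : p - Sh (-2) p = Na a Z + y3 + y4 + y5 := by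
    apply E_ext; intro k
    simp only [E_sub, E_add, Na_apply, Sh_apply, hy3, hy4, hy5, hZ, hp]
    have t1 := (th_pos ε (k + 1)).ne'
    have t2 := (th_pos ε (k + -1)).ne'
    have t3 := (th_pos ε (k + -2)).ne'
    have g1 := hgz k
    have g2 := hgz (k + -2)
    have e1 : k + -2 + 1 = k + -1 := by ring
    have e2 : k + -2 - 1 = k + -1 - 2 := by ring
    have e3 : k + 1 - 2 = k + -1 := by ring
    have e4 : k - 1 = k + -1 := by ring
    have e5 : k - 2 = k + -2 := by ring
    rw [e1, e2] at g2
    rw [e4] at g1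
    simp only [e3, e4, e5]
    rw [g1, g2]
    field_simp
    ring
  have hZeq : Z = c • (HL (y3 + y4 + y5) + (2 * ε) • y1 + (2 * ε) • y2) + c • HL (Na a Z) := by
    have : HL p - Sh (-2) (HL p) = HL (Na a Z + y3 + y4 + y5) := by
      rw [← hsplit, map_sub, HL_Sh]
    change c • (HL p - Sh (-2) (HL p) + (2 * ε) • y1 + (2 * ε) • y2) = _
    rw [this, ← smul_add]
    congr 1
    simp only [map_add]
    abel
  refine (energy a c Z _ hZeq).trans ?_
  rw [norm_smul, Real.norm_eq_abs]
  refine mul_le_mul_of_nonneg_left ?_ (abs_nonneg c)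
  have n1 : ‖HL (y3 + y4 + y5) + (2 * ε) • y1 + (2 * ε) • y2‖ ≤
      ‖y3‖ + ‖y4‖ + ‖y5‖ + 2 * ε * ‖y1‖ + 2 * ε * ‖y2‖ := by
    refine (norm_add₃_le).trans ?_
    rw [LinearIsometry.norm_map, norm_smul, norm_smul, Real.norm_of_nonneg (by positivity)]
    have := norm_add₃_le (a := y3) (b := y4) (c := y5)
    linarith
  have n2 := mul_le_mul_of_nonneg_left ny1 (by positivity : 0 ≤ 2 * ε)
  have n3 := mul_le_mul_of_nonneg_left ny2 (by positivity : 0 ≤ 2 * ε)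
  linarith


theorem mul_tendsto_zero (b : ℕ → ℤ → ℝ) (hb : ∀ n k, |b n k| ≤ 2)
    (hb0 : ∀ k, Tendsto (fun n => b n k) atTop (nhds 0)) (y : E2) (Y : ℕ → E2)
    (hY : ∀ n k, Y n k = b n k * y k) : Tendsto (fun n => ‖Y n‖) atTop (nhds 0) := by
  have h : Tendsto (fun n => ∑' k, (Y n k) ^ 2) atTop (nhds (∑' _ : ℤ, (0 : ℝ))) := by
    refine tendsto_tsum_of_dominated_convergence (bound := fun k => 4 * y k ^ 2)
      ((E_summable y).mul_left 4) ?_ ?_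
    · intro k
      have : Tendsto (fun n => (b n k * y k) ^ 2) atTop (nhds ((0 * y k) ^ 2)) :=
        ((hb0 k).mul_const _).pow 2
      simpa [hY] using this
    · refine Eventually.of_forall fun n k => ?_
      rw [Real.norm_of_nonneg (sq_nonneg _), hY, mul_pow]
      have : b n k ^ 2 ≤ 4 := by
        rw [← sq_abs]; nlinarith [hb n k, abs_nonneg (b n k)]
      gcongr
  have h2 := (Real.continuous_sqrt.tendsto _).comp h
  simp only [tsum_zero, Real.sqrt_zero] at h2
  refine h2.congr fun n => ?_
  simp only [Function.comp]
  rw [← E_norm_sq, Real.sqrt_sq (norm_nonneg _)]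

theorem two_periodic_WS {g : ℤ → ℝ} (hg : WS g) (hper : ∀ k, g (k + 2) = g k) (k : ℤ) :
    g k = 0 := by
  by_contra h0
  have hn : ∀ n : ℕ, g (k + 2 * n) = g k := by
    intro n
    induction n with
    | zero => simp
    | succ n ih => rw [← ih, ← hper (k + 2 * n)]; push_cast; congr 1; ring
  have inj : Function.Injective (fun n : ℕ => k + 2 * (n : ℤ)) := fun a b h => by simpa using h
  have hs := Summable.comp_injective hg inj
  have hpos : 0 < |g k| := abs_pos.2 h0
  have : Summable (fun n : ℕ => 1 / ((n : ℝ) + 1)) := by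
    refine Summable.of_nonneg_of_le (fun n => by positivity) (fun n => ?_)
      (hs.mul_left ((2 * (1 + |(k : ℝ)|)) / |g k|))
    simp only [Function.comp, hn]
    have e : (2 * (1 + |(k : ℝ)|)) / |g k| * (|g k| / (1 + |((k + 2 * (n : ℤ) : ℤ) : ℝ)|))
      = (2 * (1 + |(k : ℝ)|)) / (1 + |((k + 2 * (n : ℤ) : ℤ) : ℝ)|) := by
      field_simp
    rw [e, div_le_div_iff₀ (by positivity) (by positivity)]
    push_cast
    have := abs_add_le (k : ℝ) (2 * n)
    rw [abs_of_nonneg (by positivity : (0 : ℝ) ≤ 2 * n)] at this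
    have hk0 := abs_nonneg (k : ℝ)
    have hn0 : (0 : ℝ) ≤ n := by positivity
    nlinarith [mul_nonneg hk0 hn0]
  have h3 : Summable (fun n : ℕ => 1 / (n : ℝ)) := by
    rw [← summable_nat_add_iff 1]
    simpa using this
  exact Real.not_summable_one_div_natCast h3

theorem WS.sq {g : ℤ → ℝ} (hg : WS g) : Summable (fun k : ℤ => (g k / (1 + |(k : ℝ)|)) ^ 2) := by
  refine Summable.of_norm_bounded_eventually hg ?_
  have h := Summable.tendsto_cofinite_zero hg
  filter_upwards [h.eventually_lt_const one_pos] with k hk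
  have e : (g k / (1 + |(k : ℝ)|)) ^ 2 = (|g k| / (1 + |(k : ℝ)|)) ^ 2 := by
    rw [div_pow, div_pow, sq_abs]
  rw [e, Real.norm_of_nonneg (sq_nonneg _)]
  have : 0 ≤ |g k| / (1 + |(k : ℝ)|) := by positivity
  nlinarith

theorem unique0 (a c : ℝ) (z g : ℤ → ℝ) (hg : WS g)
    (hgz : ∀ j, g j = z (j + 1) + z (j - 1) - a * z j)
    (hz : ∀ j, z j = c * ∑' k, g k * hk (j - k)) : ∀ j, z j = 0 := by
  let y : E2 := mkE _ hg.sq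
  have hy : ∀ k, g k = (1 + |(k : ℝ)|) * y k := by
    intro k; simp only [y, mkE_apply]; field_simp
  let ε : ℕ → ℝ := fun n => 1 / ((n : ℝ) + 1)
  have hε : ∀ n, 0 < ε n := fun n => by simp only [ε]; positivity
  have hε1 : ∀ n, ε n ≤ 1 := fun n => by
    simp only [ε]; rw [div_le_one (by positivity)]; linarith [Nat.cast_nonneg (α := ℝ) n]
  have hεt : Tendsto ε atTop (nhds 0) := tendsto_one_div_add_atTop_nhds_zero_nat
  let b1 : ℕ → ℤ → ℝ := fun n k => ε n * th (ε n) k * (1 + |(k : ℝ)|)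
  let b2 : ℕ → ℤ → ℝ := fun n k => ε n * (ε n * k * th (ε n) k) * (1 + |(k : ℝ)|)
  have hT : ∀ n k, 0 ≤ ε n * th (ε n) k ∧ ε n * th (ε n) k ≤ ε n := fun n k =>
    ⟨mul_nonneg (hε n).le (th_pos _ _).le, mul_le_of_le_one_right (hε n).le (th_le _ _)⟩
  have hb1 : ∀ n k, |b1 n k| ≤ 2 := by
    intro n k
    have h1 := th_x (hε n) k
    have h2 := hT n k
    have h3 : |ε n * k * th (ε n) k| = ε n * th (ε n) k * |(k : ℝ)| := by
      rw [abs_mul, abs_mul, abs_of_pos (hε n), abs_of_pos (th_pos _ _)]; ring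
    rw [h3] at h1
    rw [abs_of_nonneg (mul_nonneg h2.1 (by positivity))]
    change ε n * th (ε n) k * (1 + |(k : ℝ)|) ≤ 2
    linarith [hε1 n]
  have hb2 : ∀ n k, |b2 n k| ≤ 2 := by
    intro n k
    have h1 := th_x (hε n) k
    have h3 : ε n ^ 2 * |(k : ℝ)| ^ 2 * th (ε n) k ≤ 1 := by
      rw [th, mul_one_div, div_le_one (by positivity), sq_abs]; linarith
    have h4 : |b2 n k| = ε n * |ε n * k * th (ε n) k| + ε n ^ 2 * |(k : ℝ)| ^ 2 * th (ε n) k := by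
      simp only [b2]
      rw [abs_mul, abs_mul, abs_of_pos (hε n), abs_of_pos (by positivity : 0 < 1 + |(k : ℝ)|),
        abs_mul, abs_mul, abs_of_pos (hε n), abs_of_pos (th_pos _ _)]; ring
    rw [h4]
    nlinarith [hε1 n, hε n, abs_nonneg (ε n * k * th (ε n) k)]
  have hb1t : ∀ k, Tendsto (fun n => b1 n k) atTop (nhds 0) := by
    intro k
    refine squeeze_zero (fun n => mul_nonneg (hT n k).1 (by positivity))
      (fun n => mul_le_mul_of_nonneg_right (hT n k).2 (by positivity)) ?_
    simpa using hεt.mul_const (1 + |(k : ℝ)|)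
  have hb2t : ∀ k, Tendsto (fun n => b2 n k) atTop (nhds 0) := by
    intro k
    rw [tendsto_zero_iff_abs_tendsto_zero]
    refine squeeze_zero (fun n => abs_nonneg _) (g := fun n => ε n * (1 + |(k : ℝ)|)) (fun n => ?_) ?_
    · simp only [Function.comp, b2]
      rw [abs_mul, abs_mul, abs_of_pos (hε n), abs_of_pos (by positivity : 0 < 1 + |(k : ℝ)|)]
      refine mul_le_mul_of_nonneg_right ?_ (by positivity)
      exact mul_le_of_le_one_right (hε n).le (th_x (hε n) k)
    · simpa using hεt.mul_const (1 + |(k : ℝ)|)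
  choose P hP _ using fun n => exists_mul (b1 n) 2 zero_le_two (hb1 n) y
  choose X hX _ using fun n => exists_mul (b2 n) 2 zero_le_two (hb2 n) y
  have hPt := mul_tendsto_zero b1 hb1 hb1t y P hP
  have hXt := mul_tendsto_zero b2 hb2 hb2t y X hX
  choose Z hZ hZn using fun n => reg_est a c z g hg hgz hz (ε n) (hε n) (hε1 n)
    ((ε n)⁻¹ • P n) ((ε n)⁻¹ • X n)
    (fun k => by
      have := (hε n).ne'
      rw [E_smul, hP, hy]; simp only [b1]; field_simp)
    (fun k => by
      have := (hε n).ne'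
      rw [E_smul, hX, hy]; simp only [b2]; field_simp)
  have hZb : ∀ᶠ n in atTop, ‖Z n‖ ≤ 2 * (|c| * (10 * ‖P n‖ + 2 * ‖X n‖)) := by
    have : Tendsto (fun n => |c| * (16 * ε n)) atTop (nhds 0) := by
      simpa using (hεt.const_mul 16).const_mul |c|
    filter_upwards [this.eventually_lt_const (by norm_num : (0 : ℝ) < 1 / 2)] with n hn
    have h := hZn n
    rw [norm_smul, norm_smul, Real.norm_of_nonneg (inv_nonneg.2 (hε n).le)] at h
    have e1 : 10 * ε n * ((ε n)⁻¹ * ‖P n‖) = 10 * ‖P n‖ := by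
      have := (hε n).ne'
      field_simp
    have e2 : 2 * ε n * ((ε n)⁻¹ * ‖X n‖) = 2 * ‖X n‖ := by
      have := (hε n).ne'
      field_simp
    rw [e1, e2] at h
    nlinarith [norm_nonneg (Z n)]
  have hZt : Tendsto (fun n => ‖Z n‖) atTop (nhds 0) := by
    refine squeeze_zero' (Eventually.of_forall fun n => norm_nonneg _) hZb ?_
    have := (((hPt.const_mul 10).add (hXt.const_mul 2)).const_mul |c|).const_mul 2
    simpa using this
  have hzper : ∀ j, z j - z (j - 2) = 0 := by
    intro j
    have t1 : Tendsto (fun n => Z n j) atTop (nhds 0) := by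
      rw [tendsto_zero_iff_abs_tendsto_zero]
      exact squeeze_zero (fun n => abs_nonneg _) (fun n => E_abs_le (Z n) j) hZt
    have t2 : Tendsto (fun n => th (ε n) j * (z j - z (j - 2))) atTop
        (nhds (1 / (1 + 0 ^ 2 * (j : ℝ) ^ 2) * (z j - z (j - 2)))) := by
      refine Tendsto.mul_const _ ?_
      simp only [th]
      exact tendsto_const_nhds.div (tendsto_const_nhds.add ((hεt.pow 2).mul_const _)) (by norm_num)
    simp only [hZ] at t1
    have := tendsto_nhds_unique t2 t1
    simpa using this
  have hg0 : ∀ k, g k = 0 := by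
    apply two_periodic_WS hg
    intro k
    have h1 := hzper (k + 2 + 1)
    have h2 := hzper (k + 2 - 1)
    have h3 := hzper (k + 2)
    rw [hgz, hgz]
    rw [show k + 2 + 1 - 2 = k + 1 by ring] at h1
    rw [show k + 2 - 1 - 2 = k - 1 by ring] at h2
    rw [show k + 2 - 2 = k by ring] at h3
    linear_combination h1 + h2 - a * h3
  intro j
  rw [hz]; simp [hg0]

/-- full-summability regularity -/
theorem reg_full (a c : ℝ) (r : E2) (q g : ℤ → ℝ) (hg : WS g)
    (hgz : ∀ j, g j = q (j + 1) + q (j - 1) - a * q j)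
    (hq : ∀ j, q j = r j + c * ∑' k, g k * hk (j - k)) : Summable (fun j => q j ^ 2) := by
  obtain ⟨s, hs⟩ := solve a c r
  have hw : WS (fun k => g k + (-1) * Na a s k) := hg.add ((WS_of_sq (E_summable (Na a s))).smul (-1))
  have hsj : ∀ j, s j = r j + c * ∑' k, Na a s k * hk (j - k) := by
    intro j
    rw [(HL_hasSum_apply (Na a s) j).tsum_eq]
    conv_lhs => rw [hs]
    rfl
  have := unique0 a c (fun j => q j - s j) _ hw (fun j => by
    simp only [Na_apply, hgz]; ring) (fun j => by
    simp only [hq j, hsj j, add_mul, mul_assoc]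
    rw [Summable.tsum_add (hg.summable j) ((HL_hasSum_apply (Na a s) j).summable.mul_left _),
      tsum_mul_left]
    ring)
  have e : (fun j => q j ^ 2) = fun j => s j ^ 2 := by
    ext j; have := this j; rw [show q j = s j by linarith]
  rw [e]; exact E_summable s

/-- if the sum at one site converges, `g` is weighted summable on the opposite parity class -/
theorem WS_of_summable (g : ℤ → ℝ) (j : ℤ) (h : Summable (fun k => g k * hk (j - k))) :
    WS (fun k => if Odd (j - k) then g k else 0) := by
  refine Summable.of_nonneg_of_le (fun k => by positivity) (fun k => ?_)
    (h.abs.mul_left (2 * (1 + |(j : ℝ)|)))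
  beta_reduce
  split_ifs with ho
  · rw [abs_mul]
    have h1 := hk_abs_ge ho
    have h2 := wt_ge j k
    calc |g k| / (1 + |(k : ℝ)|) = |g k| * (1 / (1 + |(k : ℝ)|)) := by ring
      _ ≤ |g k| * ((1 + |(j : ℝ)|) * (2 * |hk (j - k)|)) := by
        refine mul_le_mul_of_nonneg_left (h2.trans ?_) (abs_nonneg _)
        gcongr
      _ = _ := by ring
  · simp only [abs_zero, zero_div]; positivity

theorem tsum_parity (g : ℤ → ℝ) (j : ℤ) :
    (fun k => g k * hk (j - k)) = fun k => (if Odd (j - k) then g k else 0) * hk (j - k) := by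
  ext k
  split_ifs with h
  · rfl
  · rw [hk_even (Int.not_odd_iff_even.1 h)]; simp

/-- mixed case: sums converge at sites `j ≡ e`, and are junk at the others. -/
theorem reg_mixed (c : ℝ) (r : E2) (q g : ℤ → ℝ) (e : ℤ)
    (hg : WS (fun k => if Odd (e - k) then g k else 0))
    (hgz : ∀ j, g j = q (j + 1) + q (j - 1) - 2 * q j)
    (hq : ∀ j, Even (e - j) → q j = r j + c * ∑' k, g k * hk (j - k))
    (hbad : ∀ j, Odd (e - j) → q j = r j) : Summable (fun j => q j ^ 2) := by
  obtain ⟨r0, hr0, _⟩ := exists_mul (fun j => if Odd (e - j) then 1 else 0) 1 zero_le_one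
    (fun j => by split_ifs <;> simp) r
  let s : E2 := r - r0 - (2 * c) • HL r0
  obtain ⟨s1, hs1, _⟩ := exists_mul (fun j => if Odd (e - j) then 0 else 1) 1 zero_le_one
    (fun j => by split_ifs <;> simp) s
  let q' : ℤ → ℝ := fun j => if Odd (e - j) then 0 else q j
  have hG : ∀ k, (if Odd (e - k) then g k else 0) + 2 * r0 k = q' (k + 1) + q' (k - 1) - 0 * q' k := by
    intro k
    simp only [q', hr0]
    by_cases h : Odd (e - k)
    · have h1 : ¬ Odd (e - (k + 1)) := by rw [Int.not_odd_iff_even]; obtain ⟨m, hm⟩ := h; exact ⟨m, by omega⟩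
      have h2 : ¬ Odd (e - (k - 1)) := by rw [Int.not_odd_iff_even]; obtain ⟨m, hm⟩ := h; exact ⟨m + 1, by omega⟩
      simp only [h, h1, h2, if_true, if_false]
      rw [hgz, hbad k h]; ring
    · have h' := Int.not_odd_iff_even.1 h
      have h1 : Odd (e - (k + 1)) := by obtain ⟨m, hm⟩ := h'; exact ⟨m - 1, by omega⟩
      have h2 : Odd (e - (k - 1)) := by obtain ⟨m, hm⟩ := h'; exact ⟨m, by omega⟩
      simp only [h, h1, h2, if_true, if_false]
      ring
  have hw : WS (fun k => (if Odd (e - k) then g k else 0) + 2 * r0 k) :=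
    hg.add ((WS_of_sq (E_summable r0)).smul 2)
  have main := reg_full 0 c s1 q' _ hw hG (by
    intro j
    simp only [add_mul, mul_assoc]
    rw [Summable.tsum_add (hg.summable j) ((HL_hasSum_apply r0 j).summable.mul_left _),
      tsum_mul_left, (HL_hasSum_apply r0 j).tsum_eq, hs1]
    simp only [q']
    by_cases h : Odd (e - j)
    · have z1 : HL r0 j = 0 := by
        rw [← (HL_hasSum_apply r0 j).tsum_eq]
        refine (tsum_congr fun k => ?_).trans tsum_zero
        rw [hr0]
        split_ifs with h2
        · rw [hk_even, mul_zero]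
          have := h2.sub_odd h
          rwa [show e - k - (e - j) = j - k by ring] at this
        · simp
      have z2 : ∑' k, (if Odd (e - k) then g k else 0) * hk (j - k) = 0 := by
        refine (tsum_congr fun k => ?_).trans tsum_zero
        split_ifs with h2
        · rw [hk_even, mul_zero]
          have := h2.sub_odd h
          rwa [show e - k - (e - j) = j - k by ring] at this
        · simp
      rw [z1, z2]; simp only [h, if_true]; ring
    · have h' := Int.not_odd_iff_even.1 h
      have hs : ∀ k, (Odd (e - k) ↔ Odd (j - k)) := by
        intro k
        obtain ⟨m, hm⟩ := h'
        constructor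
        · rintro ⟨n, hn⟩; exact ⟨n - m, by omega⟩
        · rintro ⟨n, hn⟩; exact ⟨n + m, by omega⟩
      simp only [h, if_false, one_mul]
      rw [hq j h', tsum_parity]
      simp only [hs, s, E_sub, E_smul, hr0]
      have h3 : ¬ Odd (j - j) := by simp
      simp only [h3, if_false]
      ring)
  have hr0s := E_summable r0
  refine (main.add hr0s).congr fun j => ?_
  simp only [q', hr0]
  by_cases h : Odd (e - j)
  · simp [h, hbad j h]
  · simp [h]

theorem regularity (c : ℝ) (r : E2) (q : ℤ → ℝ)
    (hq : ∀ j, q j = r j + c * ∑' k, (q (k + 1) + q (k - 1) - 2 * q k) * hk (j - k)) :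
    Summable (fun j => q j ^ 2) := by
  let g : ℤ → ℝ := fun k => q (k + 1) + q (k - 1) - 2 * q k
  have hgz : ∀ j, g j = q (j + 1) + q (j - 1) - 2 * q j := fun j => rfl
  have hq' : ∀ j, q j = r j + c * ∑' k, g k * hk (j - k) := hq
  have par : ∀ e j : ℤ, Even (e - j) → ∀ k, (Odd (e - k) ↔ Odd (j - k)) := by
    rintro e j ⟨m, hm⟩ k
    constructor
    · rintro ⟨n, hn⟩; exact ⟨n - m, by omega⟩
    · rintro ⟨n, hn⟩; exact ⟨n + m, by omega⟩
  have junk : ∀ e : ℤ, ¬ WS (fun k => if Odd (e - k) then g k else 0) →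
      ∀ j, Even (e - j) → q j = r j := by
    intro e he j hj
    have : ¬ Summable (fun k => g k * hk (j - k)) := by
      intro hs
      apply he
      have := WS_of_summable g j hs
      simpa only [par e j hj] using this
    rw [hq' j, tsum_eq_zero_of_not_summable this]; ring
  have e01 : ∀ j : ℤ, Odd (0 - j) ↔ Even (1 - j) := fun j => by
    constructor
    · rintro ⟨n, hn⟩; exact ⟨n + 1, by omega⟩
    · rintro ⟨n, hn⟩; exact ⟨n - 1, by omega⟩
  have e10 : ∀ j : ℤ, Odd (1 - j) ↔ Even (0 - j) := fun j => by
    constructor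
    · rintro ⟨n, hn⟩; exact ⟨n, by omega⟩
    · rintro ⟨n, hn⟩; exact ⟨n, by omega⟩
  by_cases h0 : WS (fun k => if Odd (0 - k) then g k else 0)
  · by_cases h1 : WS (fun k => if Odd (1 - k) then g k else 0)
    · refine reg_full 2 c r q g ?_ hgz hq'
      have := h0.add h1
      convert this using 2 with k
      by_cases h : Odd (0 - k)
      · have h2 : ¬ Odd (1 - k) := by rw [Int.not_odd_iff_even, ← e01]; exact h
        simp only [h, h2, if_true, if_false, add_zero]
      · have h2 : Odd (1 - k) := by rw [e10, ← Int.not_odd_iff_even]; exact h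
        simp only [h, h2, if_true, if_false, zero_add]
    · exact reg_mixed c r q g 0 h0 hgz (fun j _ => hq' j)
        (fun j hj => junk 1 h1 j ((e01 j).1 hj))
  · by_cases h1 : WS (fun k => if Odd (1 - k) then g k else 0)
    · exact reg_mixed c r q g 1 h1 hgz (fun j _ => hq' j)
        (fun j hj => junk 0 h0 j ((e10 j).1 hj))
    · refine (E_summable r).congr fun j => ?_
      rcases Int.even_or_odd (0 - j) with h | h
      · rw [junk 0 h0 j h]
      · rw [junk 1 h1 j ((e01 j).1 h)]


/-- forward difference on ℓ² -/
noncomputable def DE (d : ℝ) : E2 →L[ℝ] E2 :=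
  d⁻¹ • ((Sh 1).toContinuousLinearMap - ContinuousLinearMap.id ℝ E2)

/-- second difference on ℓ² -/
noncomputable def LapE (d : ℝ) : E2 →L[ℝ] E2 := (d ^ 2)⁻¹ • Na 2

theorem DE_eq (d : ℝ) (x : E2) : DE d x = d⁻¹ • (Sh 1 x - x) := rfl
theorem LapE_eq (d : ℝ) (x : E2) : LapE d x = (d ^ 2)⁻¹ • Na 2 x := rfl
theorem DE_apply (d : ℝ) (x : E2) (j : ℤ) : DE d x j = d⁻¹ * (x (j + 1) - x j) := rfl
theorem LapE_apply (d : ℝ) (x : E2) (j : ℤ) :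
    LapE d x j = (d ^ 2)⁻¹ * (x (j + 1) + x (j - 1) - 2 * x j) := rfl

theorem Dp_fun (d : ℝ) (x : E2) (j : ℤ) : Dp d x j = DE d x j := by
  rw [DE_apply, Dp]; ring

theorem DpDm (d : ℝ) (u : ℤ → ℝ) (j : ℤ) :
    Dp d (Dm d u) j = (d ^ 2)⁻¹ * (u (j + 1) + u (j - 1) - 2 * u j) := by
  simp only [Dp, Dm, add_sub_cancel_right]
  by_cases h : d = 0
  · simp [h]
  · field_simp; ring

theorem Hdisc_lap (d : ℝ) (u : ℤ → ℝ) (j : ℤ) : Hdisc (Dp d (Dm d u)) j =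
    (d ^ 2)⁻¹ * ∑' k, (u (k + 1) + u (k - 1) - 2 * u k) * hk (j - k) := by
  rw [Hdisc_eq, ← tsum_mul_left]
  congr 1; ext k; rw [DpDm]; ring

theorem h2_eq (d : ℝ) (x : E2) :
    h2norm d x = Real.sqrt (d * ‖x‖ ^ 2 + d * ‖DE d x‖ ^ 2 + d * ‖LapE d x‖ ^ 2) := by
  simp only [h2norm, E_norm_sq, Dp_fun, DpDm, LapE_apply]

theorem h2_nonneg (d : ℝ) (u : ℤ → ℝ) : 0 ≤ h2norm d u := Real.sqrt_nonneg _

theorem h2_sq {d : ℝ} (hd : 0 < d) (x : E2) :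
    h2norm d x ^ 2 = d * ‖x‖ ^ 2 + d * ‖DE d x‖ ^ 2 + d * ‖LapE d x‖ ^ 2 := by
  rw [h2_eq, Real.sq_sqrt (by positivity)]

theorem h2_smul {d : ℝ} (hd : 0 < d) {c : ℝ} (hc : 0 ≤ c) (x : E2) :
    h2norm d (c • x : E2) = c * h2norm d x := by
  refine (pow_left_inj₀ (h2_nonneg _ _) (mul_nonneg hc (h2_nonneg _ _)) two_ne_zero).1 ?_
  rw [mul_pow, h2_sq hd, h2_sq hd]
  simp only [map_smul, norm_smul, mul_pow, Real.norm_eq_abs, sq_abs]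
  ring

theorem h2_mink {d : ℝ} (hd : 0 < d) (x y z : E2) (h0 : ‖x‖ ≤ ‖y‖ + ‖z‖)
    (h1 : ‖DE d x‖ ≤ ‖DE d y‖ + ‖DE d z‖) (h2 : ‖LapE d x‖ ≤ ‖LapE d y‖ + ‖LapE d z‖) :
    h2norm d x ≤ h2norm d y + h2norm d z := by
  refine le_of_sq_le_sq ?_ (add_nonneg (h2_nonneg _ _) (h2_nonneg _ _))
  have hy := h2_sq hd y
  have hz := h2_sq hd z
  have hc : d * (‖y‖ * ‖z‖ + ‖DE d y‖ * ‖DE d z‖ + ‖LapE d y‖ * ‖LapE d z‖)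
      ≤ h2norm d y * h2norm d z := by
    refine le_of_sq_le_sq ?_ (mul_nonneg (h2_nonneg _ _) (h2_nonneg _ _))
    rw [mul_pow (h2norm d y), hy, hz]
    have : 0 ≤ d ^ 2 * ((‖y‖ * ‖DE d z‖ - ‖DE d y‖ * ‖z‖) ^ 2 + (‖y‖ * ‖LapE d z‖ - ‖LapE d y‖ * ‖z‖) ^ 2
      + (‖DE d y‖ * ‖LapE d z‖ - ‖LapE d y‖ * ‖DE d z‖) ^ 2) := by positivity
    nlinarith
  have e0 := pow_le_pow_left₀ (norm_nonneg _) h0 2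
  have e1 := pow_le_pow_left₀ (norm_nonneg _) h1 2
  have e2 := pow_le_pow_left₀ (norm_nonneg _) h2 2
  rw [h2_sq hd x, add_sq, hy, hz]
  have := mul_le_mul_of_nonneg_left (add_le_add (add_le_add e0 e1) e2) hd.le
  nlinarith

theorem h2_add {d : ℝ} (hd : 0 < d) (y z : E2) :
    h2norm d (y + z : E2) ≤ h2norm d y + h2norm d z := by
  refine h2_mink hd _ y z (norm_add_le _ _) ?_ ?_
  · rw [map_add]; exact norm_add_le _ _
  · rw [map_add]; exact norm_add_le _ _

theorem sobolev {d : ℝ} (hd : 0 < d) (f : E2) (j : ℤ) :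
    f j ^ 2 ≤ d * ‖f‖ ^ 2 + d * ‖DE d f‖ ^ 2 := by
  let F : ℤ → ℝ := fun k => d * (DE d f k ^ 2 + (f (k + 1) ^ 2 + f k ^ 2) / 2)
  have hF : HasSum F (d * (‖DE d f‖ ^ 2 + (‖f‖ ^ 2 + ‖f‖ ^ 2) / 2)) := by
    have h1 : HasSum (fun k => f k ^ 2) (‖f‖ ^ 2) := by
      rw [E_norm_sq]; exact (E_summable f).hasSum
    have h2 : HasSum (fun k => f (k + 1) ^ 2) (‖f‖ ^ 2) := by
      rw [← (Sh 1).norm_map f, E_norm_sq]; exact (E_summable (Sh 1 f)).hasSum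
    have h3 : HasSum (fun k => DE d f k ^ 2) (‖DE d f‖ ^ 2) := by
      rw [E_norm_sq]; exact (E_summable _).hasSum
    exact (h3.add ((h2.add h1).div_const 2)).mul_left d
  have hF0 : ∀ k, 0 ≤ F k := fun k => by simp only [F]; positivity
  have inj : Function.Injective (fun n : ℕ => j + (n : ℤ)) := fun a b h => by simpa using h
  have step : ∀ k, f k ^ 2 - f (k + 1) ^ 2 ≤ F k := by
    intro k
    have e : f (k + 1) - f k = d * DE d f k := by rw [DE_apply]; field_simp
    have e2 : f k ^ 2 - f (k + 1) ^ 2 = d * (-(DE d f k) * (f (k + 1) + f k)) := by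
      linear_combination (-(f (k + 1) + f k)) * e
    rw [e2]
    refine mul_le_mul_of_nonneg_left ?_ hd.le
    nlinarith [sq_nonneg (DE d f k + f (k + 1)), sq_nonneg (DE d f k + f k)]
  have bd : ∀ n : ℕ, f j ^ 2 - f (j + n) ^ 2 ≤ ∑' k, F k := by
    intro n
    have h1 := Finset.sum_range_sub' (fun i : ℕ => f (j + i) ^ 2) n
    simp only [Nat.cast_zero, add_zero] at h1
    rw [← h1]
    calc _ ≤ ∑ i ∈ Finset.range n, F (j + i) := by
          refine Finset.sum_le_sum fun i _ => ?_
          have := step (j + i)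
          push_cast; rw [← add_assoc]; exact this
      _ ≤ ∑' i : ℕ, F (j + i) :=
          (hF.summable.comp_injective inj).sum_le_tsum _ (fun i _ => hF0 _)
      _ ≤ ∑' k, F k := tsum_comp_le_tsum_of_inj hF.summable hF0 inj
  have t : Tendsto (fun n : ℕ => f j ^ 2 - f (j + n) ^ 2) atTop (nhds (f j ^ 2 - 0)) := by
    refine tendsto_const_nhds.sub ?_
    have := (E_summable f).tendsto_cofinite_zero.comp inj.tendsto_cofinite
    rwa [Nat.cofinite_eq_atTop] at this
  have := le_of_tendsto t (Eventually.of_forall bd)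
  rw [hF.tsum_eq] at this
  linarith

theorem DEDE_norm (d : ℝ) (x : E2) : ‖DE d (DE d x)‖ = ‖LapE d x‖ := by
  rw [← (Sh 1).norm_map (LapE d x)]
  congr 1
  apply E_ext; intro j
  simp only [DE_apply, Sh_apply, LapE_apply, add_sub_cancel_right]
  by_cases h : d = 0
  · simp [h]
  · field_simp; ring

theorem sup_le_h2 {d : ℝ} (hd : 0 < d) (f : E2) (j : ℤ) : |f j| ≤ h2norm d f := by
  refine abs_le_of_sq_le_sq ?_ (h2_nonneg _ _)
  rw [h2_sq hd]
  have := sobolev hd f j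
  have : 0 ≤ d * ‖LapE d f‖ ^ 2 := by positivity
  linarith

theorem supD_le_h2 {d : ℝ} (hd : 0 < d) (f : E2) (j : ℤ) : |DE d f j| ≤ h2norm d f := by
  refine abs_le_of_sq_le_sq ?_ (h2_nonneg _ _)
  rw [h2_sq hd]
  have := sobolev hd (DE d f) j
  rw [DEDE_norm] at this
  have : 0 ≤ d * ‖f‖ ^ 2 := by positivity
  linarith

/-- averaging operator -/
noncomputable def AE : E2 →L[ℝ] E2 :=
  (1 / 3 : ℝ) • ((Sh 1).toContinuousLinearMap + ContinuousLinearMap.id ℝ E2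
    + (Sh (-1)).toContinuousLinearMap)

/-- half central difference -/
noncomputable def BE : E2 →L[ℝ] E2 :=
  (1 / 2 : ℝ) • ((Sh 1).toContinuousLinearMap - (Sh (-1)).toContinuousLinearMap)

theorem AE_eq (x : E2) : AE x = (1 / 3 : ℝ) • (Sh 1 x + x + Sh (-1) x) := rfl
theorem BE_eq (x : E2) : BE x = (1 / 2 : ℝ) • (Sh 1 x - Sh (-1) x) := rfl
theorem AE_apply (x : E2) (j : ℤ) : AE x j = 1 / 3 * (x (j + 1) + x j + x (j - 1)) := rfl
theorem BE_apply (x : E2) (j : ℤ) : BE x j = 1 / 2 * (x (j + 1) - x (j - 1)) := rfl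

theorem AE_norm (x : E2) : ‖AE x‖ ≤ ‖x‖ := by
  rw [AE_eq, norm_smul]
  have := norm_add₃_le (a := Sh 1 x) (b := x) (c := Sh (-1) x)
  rw [LinearIsometry.norm_map, LinearIsometry.norm_map] at this
  norm_num; linarith

theorem BE_norm (x : E2) : ‖BE x‖ ≤ ‖x‖ := by
  rw [BE_eq, norm_smul]
  have := norm_sub_le (Sh 1 x) (Sh (-1) x)
  rw [LinearIsometry.norm_map, LinearIsometry.norm_map] at this
  norm_num; linarith

theorem AE_sup (x : E2) (m : ℝ) (h : ∀ j, |x j| ≤ m) (j : ℤ) : |AE x j| ≤ m := by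
  rw [AE_apply, abs_le]
  have h1 := abs_le.1 (h (j + 1)); have h2 := abs_le.1 (h j); have h3 := abs_le.1 (h (j - 1))
  constructor <;> linarith

theorem BE_sup (x : E2) (m : ℝ) (h : ∀ j, |x j| ≤ m) (j : ℤ) : |BE x j| ≤ m := by
  rw [BE_apply, abs_le]
  have h1 := abs_le.1 (h (j + 1)); have h3 := abs_le.1 (h (j - 1))
  constructor <;> linarith

theorem AE_DE (d : ℝ) (x : E2) : DE d (AE x) = AE (DE d x) := by
  apply E_ext; intro j; simp only [DE_apply, AE_apply, add_sub_cancel_right, sub_add_cancel]; ring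
theorem BE_DE (d : ℝ) (x : E2) : DE d (BE x) = BE (DE d x) := by
  apply E_ext; intro j; simp only [DE_apply, BE_apply, add_sub_cancel_right, sub_add_cancel]; ring
theorem AE_LapE (d : ℝ) (x : E2) : LapE d (AE x) = AE (LapE d x) := by
  apply E_ext; intro j; simp only [LapE_apply, AE_apply, add_sub_cancel_right, sub_add_cancel]; ring
theorem BE_LapE (d : ℝ) (x : E2) : LapE d (BE x) = BE (LapE d x) := by
  apply E_ext; intro j; simp only [LapE_apply, BE_apply, add_sub_cancel_right, sub_add_cancel]; ring

theorem Gnl_eq (d : ℝ) (f : E2) (j : ℤ) : Gnl d f j = d⁻¹ * (AE f j * BE f j) := by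
  rw [Gnl, AE_apply, BE_apply]
  by_cases h : d = 0
  · simp [h]
  · field_simp

theorem G_exists {d : ℝ} (hd : 0 < d) (f : E2) : ∃ G : E2, (∀ j, G j = Gnl d f j) ∧
    h2norm d G ≤ 4 / d * h2norm d f ^ 2 := by
  set N := h2norm d f with hN
  have hN0 : 0 ≤ N := h2_nonneg _ _
  have hs := sup_le_h2 hd f
  have hsD := supD_le_h2 hd f
  have hA := AE_sup f N hs
  have hB := BE_sup f N hs
  have hDA : ∀ j, |DE d (AE f) j| ≤ N := by rw [AE_DE]; exact AE_sup _ N hsD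
  obtain ⟨P, hP, nP⟩ := exists_mul (AE f) N hN0 hA (BE f)
  obtain ⟨y1, hy1, ny1⟩ := exists_mul (DE d (AE f)) N hN0 hDA (Sh 1 (BE f))
  obtain ⟨y2, hy2, ny2⟩ := exists_mul (AE f) N hN0 hA (DE d (BE f))
  obtain ⟨x1, hx1, nx1⟩ := exists_mul (AE f) N hN0 hA (LapE d (BE f))
  obtain ⟨x2, hx2, nx2⟩ := exists_mul (BE f) N hN0 hB (LapE d (AE f))
  obtain ⟨x3, hx3, nx3⟩ := exists_mul (DE d (AE f)) N hN0 hDA (DE d (BE f))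
  have hDP : DE d P = y1 + y2 := by
    apply E_ext; intro j
    rw [E_add, hy1, hy2]
    simp only [DE_apply, Sh_apply, hP]
    ring
  have hLP : LapE d P = x1 + x2 + (x3 + Sh (-1) x3) := by
    apply E_ext; intro j
    simp only [E_add, Sh_apply, hx1, hx2, hx3]
    simp only [DE_apply, LapE_apply, hP, ← sub_eq_add_neg, sub_add_cancel]
    field_simp
    ring
  have b0 := BE_norm f
  have b1 : ‖DE d (BE f)‖ ≤ ‖DE d f‖ := by rw [BE_DE]; exact BE_norm _
  have b2 : ‖LapE d (BE f)‖ ≤ ‖LapE d f‖ := by rw [BE_LapE]; exact BE_norm _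
  have a2 : ‖LapE d (AE f)‖ ≤ ‖LapE d f‖ := by rw [AE_LapE]; exact AE_norm _
  rw [LinearIsometry.norm_map] at ny1
  have c0 : ‖P‖ ≤ N * ‖f‖ := nP.trans (by gcongr)
  have c1 : ‖DE d P‖ ≤ N * (‖f‖ + ‖DE d f‖) := by
    rw [hDP]
    refine (norm_add_le _ _).trans ?_
    have := mul_le_mul_of_nonneg_left b0 hN0
    have := mul_le_mul_of_nonneg_left b1 hN0
    linarith
  have c2 : ‖LapE d P‖ ≤ N * (2 * ‖LapE d f‖ + 2 * ‖DE d f‖) := by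
    rw [hLP]
    have i1 := norm_add_le (x1 + x2) (x3 + Sh (-1) x3)
    have i2 := norm_add_le x1 x2
    have i3 := norm_add_le x3 (Sh (-1) x3)
    rw [LinearIsometry.norm_map] at i3
    have := mul_le_mul_of_nonneg_left b1 hN0
    have := mul_le_mul_of_nonneg_left b2 hN0
    have := mul_le_mul_of_nonneg_left a2 hN0
    linarith
  have hPn : h2norm d P ≤ 4 * N ^ 2 := by
    refine le_of_sq_le_sq ?_ (by positivity)
    have hNs := h2_sq hd f
    rw [← hN] at hNs
    rw [h2_sq hd]
    have s0 := pow_le_pow_left₀ (norm_nonneg _) c0 2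
    have s1 := pow_le_pow_left₀ (norm_nonneg _) c1 2
    have s2 := pow_le_pow_left₀ (norm_nonneg _) c2 2
    rw [mul_pow] at s0 s1 s2
    have t1 : (‖f‖ + ‖DE d f‖) ^ 2 ≤ 2 * ‖f‖ ^ 2 + 2 * ‖DE d f‖ ^ 2 := by
      nlinarith [sq_nonneg (‖f‖ - ‖DE d f‖)]
    have t2 : (2 * ‖LapE d f‖ + 2 * ‖DE d f‖) ^ 2 ≤ 8 * ‖LapE d f‖ ^ 2 + 8 * ‖DE d f‖ ^ 2 := by
      nlinarith [sq_nonneg (‖LapE d f‖ - ‖DE d f‖)]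
    have t3 : ‖P‖ ^ 2 + ‖DE d P‖ ^ 2 + ‖LapE d P‖ ^ 2 ≤
        N ^ 2 * (16 * (‖f‖ ^ 2 + ‖DE d f‖ ^ 2 + ‖LapE d f‖ ^ 2)) := by
      have k1 := mul_le_mul_of_nonneg_left t1 (sq_nonneg N)
      have k2 := mul_le_mul_of_nonneg_left t2 (sq_nonneg N)
      have : 0 ≤ N ^ 2 * (13 * ‖f‖ ^ 2 + 6 * ‖DE d f‖ ^ 2 + 8 * ‖LapE d f‖ ^ 2) := by positivity
      linarith
    have t4 := mul_le_mul_of_nonneg_left t3 hd.le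
    calc d * ‖P‖ ^ 2 + d * ‖DE d P‖ ^ 2 + d * ‖LapE d P‖ ^ 2
        = d * (‖P‖ ^ 2 + ‖DE d P‖ ^ 2 + ‖LapE d P‖ ^ 2) := by ring
      _ ≤ _ := t4
      _ = 16 * N ^ 2 * (d * ‖f‖ ^ 2 + d * ‖DE d f‖ ^ 2 + d * ‖LapE d f‖ ^ 2) := by ring
      _ = (4 * N ^ 2) ^ 2 := by rw [← hNs]; ring
  refine ⟨d⁻¹ • P, fun j => by rw [E_smul, hP, Gnl_eq], ?_⟩
  rw [h2_smul hd (by positivity)]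
  calc d⁻¹ * h2norm d P ≤ d⁻¹ * (4 * N ^ 2) := by gcongr
    _ = _ := by ring

theorem G_lip {d : ℝ} (hd : 0 < d) (M : ℝ) (hM : 0 ≤ M) (f g F G : E2) (hf : ∀ j, |f j| ≤ M)
    (hg : ∀ j, |g j| ≤ M) (hF : ∀ j, F j = Gnl d f j) (hG : ∀ j, G j = Gnl d g j) :
    ‖F - G‖ ≤ 2 * M / d * ‖f - g‖ := by
  obtain ⟨x, hx, nx⟩ := exists_mul (AE f) M hM (AE_sup f M hf) (BE (f - g))
  obtain ⟨y, hy, ny⟩ := exists_mul (BE g) M hM (BE_sup g M hg) (AE (f - g))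
  have e : F - G = d⁻¹ • (x + y) := by
    apply E_ext; intro j
    simp only [E_sub, E_smul, E_add, hF, hG, Gnl_eq, hx, hy, map_sub]
    ring
  rw [e, norm_smul, Real.norm_of_nonneg (by positivity)]
  have h1 := mul_le_mul_of_nonneg_left (BE_norm (f - g)) hM
  have h2 := mul_le_mul_of_nonneg_left (AE_norm (f - g)) hM
  have h3 := norm_add_le x y
  calc d⁻¹ * ‖x + y‖ ≤ d⁻¹ * (2 * M * ‖f - g‖) := by gcongr; linarith
    _ = _ := by ring

theorem DE_T (d : ℝ) (x : E2) : DE d (HL (Na 2 x)) = HL (Na 2 (DE d x)) := by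
  simp only [Na_eq, DE_eq, map_sub, map_add, map_smul, HL_Sh]
  apply E_ext; intro j
  simp only [E_sub, E_add, E_smul, Sh_apply]
  rw [show j + -1 + 1 = j + 1 + -1 by ring]
  ring

theorem LapE_T (d : ℝ) (x : E2) : LapE d (HL (Na 2 x)) = HL (Na 2 (LapE d x)) := by
  rw [LapE_eq, LapE_eq, ← Na_HL 2 (Na 2 x), map_smul, map_smul]

theorem h2_energy {d : ℝ} (hd : 0 < d) (c : ℝ) (x y e : E2)
    (h : x = y + e + c • HL (Na 2 (y + x))) : h2norm d x ≤ h2norm d y + h2norm d e := by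
  refine h2_mink hd x y e (energy_iso 2 c x y e h) ?_ ?_
  · refine energy_iso 2 c _ _ _ ?_
    conv_lhs => rw [h]
    simp only [map_add, map_smul, DE_T]
  · refine energy_iso 2 c _ _ _ ?_
    conv_lhs => rw [h]
    simp only [map_add, map_smul, LapE_T]


theorem Hlap_E (d : ℝ) (q : E2) (j : ℤ) :
    Hdisc (Dp d (Dm d q)) j = (d ^ 2)⁻¹ * HL (Na 2 q) j := by
  rw [Hdisc_lap, ← (HL_hasSum_apply (Na 2 q) j).tsum_eq]
  rfl

theorem cn_step {d t : ℝ} (hd : 0 < d) (ht : 0 < t) (V G : E2) (x : ℤ → ℝ)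
    (hx : ∀ j, x j = V j + t * G j + t / 2 * Hdisc (Dp d (Dm d (fun i => V i + x i))) j) :
    ∃ X : E2, (∀ j, X j = x j) ∧
      X = V + t • G + (t / 2 * (d ^ 2)⁻¹) • HL (Na 2 (V + X)) := by
  have hs := regularity (t / 2 * (d ^ 2)⁻¹) ((2 : ℝ) • V + t • G) (fun i => V i + x i) (by
    intro j
    have := hx j
    rw [Hdisc_lap] at this
    simp only [E_add, E_smul]
    linarith)
  refine ⟨mkE _ hs - V, fun j => by rw [E_sub, mkE_apply]; ring, ?_⟩
  have e : V + (mkE _ hs - V) = mkE _ hs := by abel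
  rw [e]
  apply E_ext; intro j
  have h1 := hx j
  have h2 := Hlap_E d (mkE _ hs) j
  have h3 : ((mkE _ hs : E2) : ℤ → ℝ) = fun i => V i + x i := by
    funext i; exact mkE_apply _ hs i
  rw [h3] at h2
  rw [h2] at h1
  simp only [E_add, E_sub, E_smul]
  rw [show (mkE _ hs : E2) j = V j + x j from mkE_apply _ hs j]
  linarith

theorem h2_tendsto (d : ℝ) (W : ℕ → E2) (U : E2) (h : Tendsto W atTop (nhds U)) :
    Tendsto (fun l => h2norm d (W l)) atTop (nhds (h2norm d U)) := by
  have c : Continuous (fun x : E2 => h2norm d x) := by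
    simp only [h2_eq]
    fun_prop
  exact (c.tendsto U).comp h

theorem eval_tendsto (W : ℕ → E2) (U : E2) (h : Tendsto W atTop (nhds U)) (j : ℤ) :
    Tendsto (fun l => W l j) atTop (nhds (U j)) := by
  rw [tendsto_iff_dist_tendsto_zero]
  rw [tendsto_iff_norm_sub_tendsto_zero] at h
  refine squeeze_zero (fun _ => dist_nonneg) (fun l => ?_) h
  rw [Real.dist_eq, ← E_sub]
  exact E_abs_le _ _

theorem main_E (d t : ℝ) (hd : 0 < d) (ht : 0 < t) (L K : ℝ) (hL0 : 0 < L) (hL1 : L < 1)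
    (hK : K = (6 - L) / (1 - L)) (V : E2) (hcfl : t / d ≤ L / (K * h2norm d V))
    (w : ℕ → ℤ → ℝ) (hw0 : w 0 = V)
    (hwrec : ∀ (l : ℕ) (j : ℤ),
      w (l + 1) j = V j + t * Gnl d (fun i => (V i + w l i) / 2) j
        + t / 2 * Hdisc (Dp d (Dm d (fun i => V i + w (l + 1) i))) j) :
    ∃ u : ℤ → ℝ,
      Tendsto (fun l => h2norm d (fun j => w l j - u j)) atTop (nhds 0)
      ∧ (∀ j : ℤ, u j = V j + t * Gnl d (fun i => (V i + u i) / 2) j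
          + t * Hdisc (Dp d (Dm d (fun i => (V i + u i) / 2))) j)
      ∧ h2norm d u ≤ K * h2norm d V := by
  have hKL : K * (1 - L) = 6 - L := by rw [hK]; field_simp [(sub_pos.2 hL1).ne']
  have hK6 : 6 ≤ K := by nlinarith
  set N := h2norm d V with hN
  have hNn : 0 ≤ N := h2_nonneg _ _
  have hNp : 0 < N := by
    rcases hNn.lt_or_eq with h | h
    · exact h
    · rw [← h, mul_zero, div_zero] at hcfl
      exact absurd (div_pos ht hd) (not_lt.2 hcfl)
  have hlam : t / d * (K * N) ≤ L := (le_div_iff₀ (by positivity)).1 hcfl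
  have hM : 0 ≤ K * N := by positivity
  set c := t / 2 * (d ^ 2)⁻¹ with hc
  have hhalf : ∀ y : E2, h2norm d y ≤ K * N →
      h2norm d ((1 / 2 : ℝ) • (V + y) : E2) ≤ (1 + K) / 2 * N := by
    intro y hy
    rw [h2_smul hd (by norm_num)]
    have := h2_add hd V y
    linarith
  have hfun : ∀ y : E2, (((1 / 2 : ℝ) • (V + y) : E2) : ℤ → ℝ) = fun i => (V i + y i) / 2 := by
    intro y; funext i; rw [E_smul, E_add]; ring
  have hstep : ∀ l (y : E2), (∀ j, y j = w l j) → h2norm d y ≤ K * N →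
      ∃ X G : E2, (∀ j, X j = w (l + 1) j) ∧ h2norm d X ≤ K * N ∧
        (∀ j, G j = Gnl d ((1 / 2 : ℝ) • (V + y) : E2) j) ∧
        X = V + t • G + c • HL (Na 2 (V + X)) := by
    intro l y hy hyn
    obtain ⟨G, hG, nG⟩ := G_exists hd ((1 / 2 : ℝ) • (V + y) : E2)
    have hyf : (y : ℤ → ℝ) = w l := funext hy
    obtain ⟨X, hX, eX⟩ := cn_step hd ht V G (w (l + 1)) (by
      intro j
      rw [hG, hfun, hyf]
      exact hwrec l j)
    refine ⟨X, G, hX, ?_, hG, eX⟩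
    have h1 := h2_energy hd c X V (t • G) eX
    rw [h2_smul hd ht.le] at h1
    have h2 : h2norm d ((1 / 2 : ℝ) • (V + y) : E2) ^ 2 ≤ ((1 + K) / 2 * N) ^ 2 :=
      pow_le_pow_left₀ (h2_nonneg _ _) (hhalf y hyn) 2
    have h3 : t * h2norm d G ≤ t / d * (1 + K) ^ 2 * N ^ 2 := by
      calc t * h2norm d G ≤ t * (4 / d * ((1 + K) / 2 * N) ^ 2) := by
            refine mul_le_mul_of_nonneg_left (nG.trans ?_) ht.le
            gcongr
        _ = _ := by field_simp; ring
    have h4 : t / d * (1 + K) ^ 2 * N ^ 2 * K ≤ (K - 1) * K * N := by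
      have a : L * (1 + K) ^ 2 ≤ K * (K - 1) := by
        have : L * (K - 1) = K - 6 := by linarith
        refine le_of_mul_le_mul_right ?_ (show 0 < K - 1 by linarith)
        calc L * (1 + K) ^ 2 * (K - 1) = (K - 6) * (1 + K) ^ 2 := by rw [← this]; ring
          _ ≤ _ := by nlinarith
      calc t / d * (1 + K) ^ 2 * N ^ 2 * K = t / d * (K * N) * ((1 + K) ^ 2 * N) := by ring
        _ ≤ L * ((1 + K) ^ 2 * N) := by gcongr
        _ = (L * (1 + K) ^ 2) * N := by ring
        _ ≤ (K * (K - 1)) * N := by gcongr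
        _ = _ := by ring
    have h5 : t / d * (1 + K) ^ 2 * N ^ 2 ≤ (K - 1) * N :=
      le_of_mul_le_mul_right (h4.trans_eq (by ring)) (show 0 < K by linarith)
    rw [← hN] at h1
    linarith
  have hex : ∀ l, ∃ y : E2, (∀ j, y j = w l j) ∧ h2norm d y ≤ K * N := by
    intro l
    induction l with
    | zero => exact ⟨V, fun j => by rw [hw0], by rw [← hN]; nlinarith⟩
    | succ l ih =>
      obtain ⟨y, hy, hyn⟩ := ih
      obtain ⟨X, G, hX, nX, -, -⟩ := hstep l y hy hyn
      exact ⟨X, hX, nX⟩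
  choose W hW nW using hex
  have hex2 : ∀ l, ∃ G : E2, (∀ j, G j = Gnl d ((1 / 2 : ℝ) • (V + W l) : E2) j) ∧
      W (l + 1) = V + t • G + c • HL (Na 2 (V + W (l + 1))) := by
    intro l
    obtain ⟨X, G, hX, -, hG, eX⟩ := hstep l (W l) (hW l) (nW l)
    have : X = W (l + 1) := E_ext (fun j => by rw [hX, hW])
    rw [this] at eX
    exact ⟨G, hG, eX⟩
  choose G hG eW using hex2
  have hsup : ∀ l j, |((1 / 2 : ℝ) • (V + W l) : E2) j| ≤ K * N := by
    intro l j
    refine (sup_le_h2 hd _ j).trans ((hhalf _ (nW l)).trans ?_)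
    nlinarith
  have hcon : ∀ l, ‖W (l + 1 + 1) - W (l + 1)‖ ≤ L * ‖W (l + 1) - W l‖ := by
    intro l
    have e : W (l + 1 + 1) - W (l + 1) = t • (G (l + 1) - G l)
        + c • HL (Na 2 (W (l + 1 + 1) - W (l + 1))) := by
      conv_lhs => rw [eW (l + 1), eW l]
      simp only [map_add, map_sub, smul_add, smul_sub]
      abel
    have h1 := energy 2 c _ _ e
    have h2 := G_lip hd (K * N) hM _ _ (G (l + 1)) (G l) (hsup (l + 1)) (hsup l) (hG _) (hG _)
    have h3 : (1 / 2 : ℝ) • (V + W (l + 1)) - (1 / 2 : ℝ) • (V + W l)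
        = (1 / 2 : ℝ) • (W (l + 1) - W l) := by
      rw [← smul_sub]; congr 1; abel
    rw [h3, norm_smul] at h2
    rw [norm_smul, Real.norm_of_nonneg ht.le] at h1
    have h4 := mul_le_mul_of_nonneg_left h2 ht.le
    refine h1.trans (h4.trans ?_)
    calc _ = t / d * (K * N) * ‖W (l + 1) - W l‖ := by norm_num; ring
      _ ≤ _ := by gcongr
  have hgeo : ∀ n, dist (W n) (W (n + 1)) ≤ ‖W (0 + 1) - W 0‖ * L ^ n := by
    intro n
    rw [dist_comm, dist_eq_norm]
    induction n with
    | zero => simp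
    | succ n ih =>
      calc _ ≤ L * ‖W (n + 1) - W n‖ := hcon n
        _ ≤ L * (‖W (0 + 1) - W 0‖ * L ^ n) := by gcongr
        _ = _ := by ring
  obtain ⟨U, hU⟩ := cauchySeq_tendsto_of_complete (cauchySeq_of_le_geometric L _ hL1 hgeo)
  refine ⟨U, ?_, ?_, ?_⟩
  · have h1 : Tendsto (fun l => W l - U) atTop (nhds 0) := by
      have := hU.sub_const U
      rwa [sub_self] at this
    have h2 := h2_tendsto d _ _ h1
    have h3 : h2norm d ((0 : E2) : ℤ → ℝ) = 0 := by rw [h2_eq]; simp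
    rw [h3] at h2
    refine h2.congr fun l => ?_
    congr 1; funext j; rw [E_sub, hW]
  · intro j
    have hU1 := hU.comp (tendsto_add_atTop_nat 1)
    have hf : Tendsto (fun l => (1 / 2 : ℝ) • (V + W l)) atTop (nhds ((1 / 2 : ℝ) • (V + U))) :=
      (hU.const_add V).const_smul _
    have l1 := eval_tendsto _ _ hU1 j
    have hg : Tendsto (fun l => G l j) atTop (nhds (Gnl d ((1 / 2 : ℝ) • (V + U) : E2) j)) := by
      simp only [hG, Gnl]
      have a1 := eval_tendsto _ _ hf (j + 1)
      have a2 := eval_tendsto _ _ hf j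
      have a3 := eval_tendsto _ _ hf (j - 1)
      exact (((a1.add a2).add a3).div_const 3).mul ((a1.sub a3).div_const _)
    have hh : Tendsto (fun l => HL (Na 2 (V + W (l + 1)))) atTop (nhds (HL (Na 2 (V + U)))) :=
      ((HL.continuous.comp (Na 2).continuous).tendsto _).comp (hU1.const_add V)
    have hj := eval_tendsto _ _ hh j
    have r := (tendsto_const_nhds (x := V j)).add (hg.const_mul t) |>.add (hj.const_mul c)
    have r2 := tendsto_nhds_unique l1 (r.congr fun l => by
      have := congrArg (fun z : E2 => z j) (eW l)
      simp only [E_add, E_smul] at this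
      exact this.symm)
    have h2 := Hlap_E d ((1 / 2 : ℝ) • (V + U)) j
    rw [hfun] at h2 r2
    rw [h2, r2, hc, map_smul, map_smul, E_smul]
    ring
  · exact le_of_tendsto (h2_tendsto d _ _ hU) (Eventually.of_forall nW)

theorem stmt_19 (Δx Δt : ℝ) (hΔx : 0 < Δx) (hΔt : 0 < Δt)
    (L K : ℝ) (hL0 : 0 < L) (hL1 : L < 1) (hK : K = (6 - L) / (1 - L))
    (v : ℤ → ℝ)
    (hv : Summable (fun j => (v j) ^ 2))
    (hDv : Summable (fun j => (Dp Δx v j) ^ 2))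
    (hDDv : Summable (fun j => (Dp Δx (Dm Δx v) j) ^ 2))
    (hcfl : Δt / Δx ≤ L / (K * h2norm Δx v))
    (w : ℕ → ℤ → ℝ) (hw0 : w 0 = v)
    (hwrec : ∀ (l : ℕ) (j : ℤ),
      w (l + 1) j = v j + Δt * Gnl Δx (fun i => (v i + w l i) / 2) j
        + Δt / 2 * Hdisc (Dp Δx (Dm Δx (fun i => v i + w (l + 1) i))) j) :
    ∃ u : ℤ → ℝ,
      Tendsto (fun l => h2norm Δx (fun j => w l j - u j)) atTop (nhds 0)
      ∧ (∀ j : ℤ, u j = v j + Δt * Gnl Δx (fun i => (v i + u i) / 2) j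
          + Δt * Hdisc (Dp Δx (Dm Δx (fun i => (v i + u i) / 2))) j)
      ∧ h2norm Δx u ≤ K * h2norm Δx v := by
  have e : ((mkE v hv : E2) : ℤ → ℝ) = v := by
    funext i; exact mkE_apply v hv i
  have := main_E Δx Δt hΔx hΔt L K hL0 hL1 hK (mkE v hv) (by rw [e]; exact hcfl) w
    (by rw [e]; exact hw0) (by rw [e]; exact hwrec)
  rw [e] at this
  exact this
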